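/- For every (T,φ) ∈ OP_Γ, the subgroup of H₁(Γ,ℤ) generated by the classes [γ] for γ ∈ Cir_φ(Γ∖T) is equal to H₁(Γ∖T,ℤ) (viewed inside H₁(Γ,ℤ) as the cycles supported on edges not in T). -/

import Mathlib

/-!
Serre-style finite graphs: a vertex type `V`, an oriented-edge type `E` with a
fixed-point-free involution `inv` (edge reversal) and source/target maps `s, t`
with `s (inv e) = t e`.  An unoriented edge is an `inv`-orbit `{e, inv e}`;
subsets of unoriented edges are encoded as `inv`-closed subsets of `E`, and an
orientation of a spanning subgraph `Γ∖T` is encoded by the set `O` of its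
positively oriented edges.  1-chains with coefficients in `A` are encoded as
functions `c : E → A` with `c (inv e) = - c e` (so that `(c, e⃗) = c e` for the
standard bilinear form).
-/

structure SerreGraph where
  V : Type
  E : Type
  [fintypeV : Fintype V]
  [fintypeE : Fintype E]
  [decEqV : DecidableEq V]
  [decEqE : DecidableEq E]
  inv : E → E
  s : E → V
  t : E → V
  inv_inv : ∀ e, inv (inv e) = e
  inv_ne : ∀ e, inv e ≠ e
  s_inv : ∀ e, s (inv e) = t e

attribute [instance] SerreGraph.fintypeV SerreGraph.fintypeE
attribute [instance] SerreGraph.decEqV SerreGraph.decEqE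

namespace SerreGraph

variable (Γ : SerreGraph)

/-- Reachability between vertices in the spanning subgraph whose allowed oriented
edges are those in `A`. -/
def Reach (A : Set Γ.E) : Γ.V → Γ.V → Prop :=
  Relation.ReflTransGen (fun a b => ∃ e ∈ A, Γ.s e = a ∧ Γ.t e = b)

/-- The number of connected components of the spanning subgraph with allowed
oriented edges `A`. -/
noncomputable def numComponents (A : Set Γ.E) : ℕ :=
  Nat.card (Quot (fun a b : Γ.V => ∃ e ∈ A, Γ.s e = a ∧ Γ.t e = b))

/-- The set of separating (oriented) edges: removing the underlying unoriented
edge increases the number of connected components. -/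
def Esep : Set Γ.E :=
  {e | Γ.numComponents Set.univ < Γ.numComponents {f | f ≠ e ∧ f ≠ Γ.inv e}}

/-- `T` encodes a set of unoriented edges. -/
def InvClosed (T : Set Γ.E) : Prop := ∀ e, e ∈ T ↔ Γ.inv e ∈ T

/-- `O` is (the set of positively oriented edges of) an orientation of `Γ∖T`. -/
def IsOrientation (T O : Set Γ.E) : Prop :=
  (∀ e ∈ O, e ∉ T) ∧ ∀ e, e ∉ T → (e ∈ O ↔ Γ.inv e ∉ O)

/-- A totally cyclic orientation of `Γ∖T`: an orientation such that there is no
vertex set `W` which is nonempty and proper inside some connected component of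
`Γ∖T` and such that all edges of `Γ∖T` crossing the boundary of `W` are oriented
out of `W` (this is the componentwise condition of the paper). -/
def IsTotallyCyclic (T O : Set Γ.E) : Prop :=
  Γ.IsOrientation T O ∧
    ¬ ∃ W : Set Γ.V, (∃ v ∈ W, ∃ w ∈ Wᶜ, Γ.Reach Tᶜ v w) ∧
        ∀ e ∈ O, Γ.t e ∈ W → Γ.s e ∈ W

/-- `γ` is (the set of positively oriented edges of) an oriented circuit of `Γ`:
a cyclic subgraph (connected, first Betti number one, no separating edges)
together with a totally cyclic orientation; equivalently a directed cycle:
each incident vertex has exactly one outgoing and one incoming edge in `γ`,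
and the support is connected. -/
def IsCircuit (γ : Finset Γ.E) : Prop :=
  γ.Nonempty ∧ (∀ e ∈ γ, Γ.inv e ∉ γ) ∧
    (∀ v ∈ γ.image Γ.s ∪ γ.image Γ.t, ∃! e, e ∈ γ ∧ Γ.s e = v) ∧
    (∀ v ∈ γ.image Γ.s ∪ γ.image Γ.t, ∃! e, e ∈ γ ∧ Γ.t e = v) ∧
    ∀ e ∈ γ, ∀ f ∈ γ, Γ.Reach ((↑γ : Set Γ.E) ∪ Γ.inv '' ↑γ) (Γ.s e) (Γ.s f)

/-- The class `[γ] ∈ H₁(Γ,ℤ)` of an oriented circuit. -/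
def circChainZ (γ : Finset Γ.E) : Γ.E → ℤ :=
  fun e => if e ∈ γ then 1 else if Γ.inv e ∈ γ then -1 else 0

/-- The class `[γ] ∈ H₁(Γ,ℝ)` of an oriented circuit. -/
noncomputable def circChainR (γ : Finset Γ.E) : Γ.E → ℝ :=
  fun e => (Γ.circChainZ γ e : ℝ)

/-- `Cir_φ(Γ∖T)`: oriented circuits of `Γ∖T` compatibly oriented with the
orientation with positive edges `O`. -/
def Cir (T O : Set Γ.E) : Set (Finset Γ.E) :=
  {γ | Γ.IsCircuit γ ∧ (∀ e ∈ γ, e ∈ O) ∧ ∀ e ∈ γ, e ∉ T}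

/-- `c` is a 1-cycle: a skew 1-chain with vanishing boundary, i.e. an element of
`H₁(Γ,A)`. -/
def IsCycle {A : Type*} [AddCommGroup A] (c : Γ.E → A) : Prop :=
  (∀ e, c (Γ.inv e) = - c e) ∧
    ∀ v, ∑ e ∈ Finset.univ.filter (fun e => Γ.t e = v), c e = 0

/-- An element of `H₁(Γ∖T, A) ⊆ H₁(Γ,A)`: a cycle supported on edges not in `T`. -/
def IsCycleOn {A : Type*} [AddCommGroup A] (T : Set Γ.E) (c : Γ.E → A) : Prop :=
  Γ.IsCycle c ∧ ∀ e ∈ T, c e = 0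

/-- The standard positive definite bilinear form on `C⃗₁(Γ,ℝ)`, for which
`(c, e⃗) = c e`. -/
noncomputable def pair (c c' : Γ.E → ℝ) : ℝ := (∑ e, c e * c' e) / 2

/-- The first Betti number `b₁(Γ) = dim_ℝ H₁(Γ,ℝ)`. -/
noncomputable def b1 : ℕ :=
  Module.finrank ℝ (Submodule.span ℝ {c : Γ.E → ℝ | Γ.IsCycle c})

/-- `b₁(Γ∖T) = dim_ℝ H₁(Γ∖T,ℝ)`. -/
noncomputable def b1Sub (T : Set Γ.E) : ℕ :=
  Module.finrank ℝ (Submodule.span ℝ {c : Γ.E → ℝ | Γ.IsCycleOn T c})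

/-- The cone `σ(T,φ) ⊆ H₁(Γ,ℝ)` of the cographic fan associated to a pair
`(T, O)` with `O` an orientation of `Γ∖T`. -/
def sigmaCone (T O : Set Γ.E) : Set (Γ.E → ℝ) :=
  {v | Γ.IsCycle v ∧ (∀ e ∈ O, 0 ≤ v e) ∧ ∀ e ∈ T, v e = 0}

/-- The poset `OP_Γ` of totally cyclic orientations: pairs `(T, O)` with `T` a
set of unoriented edges and `O` a totally cyclic orientation of `Γ∖T`. -/
def OP : Set (Set Γ.E × Set Γ.E) :=
  {p | Γ.InvClosed p.1 ∧ Γ.IsTotallyCyclic p.1 p.2}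

/-- The order on `OP_Γ`: `(T',φ') ≤ (T,φ)` iff `T' ⊇ T` and `φ'` is the
restriction of `φ`. -/
def OPle (p q : Set Γ.E × Set Γ.E) : Prop :=
  q.1 ⊆ p.1 ∧ p.2 = q.2 ∩ p.1ᶜ

/-- `H₁(Γ,ℤ)` viewed as the set of lattice points of `H₁(Γ,ℝ)`. -/
def H1Z : Set (Γ.E → ℝ) := {c | Γ.IsCycle c ∧ ∀ e, ∃ n : ℤ, c e = (n : ℝ)}

/-- The Voronoi polytope `Vor_Γ ⊆ H₁(Γ,ℝ)`. -/
def voronoi : Set (Γ.E → ℝ) :=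
  {v | Γ.IsCycle v ∧ ∀ l ∈ Γ.H1Z, Γ.pair v v ≤ Γ.pair (v - l) (v - l)}

/-- A (exposed) face of the Voronoi polytope. -/
def IsVorFace (F : Set (Γ.E → ℝ)) : Prop :=
  ∃ l : (Γ.E → ℝ) →ₗ[ℝ] ℝ, F = {v | v ∈ Γ.voronoi ∧ ∀ w ∈ Γ.voronoi, l w ≤ l v}

/-- The face `F(T,φ)` of the Voronoi polytope associated to `(T,O) ∈ OP_Γ`. -/
def vorFace (T O : Set Γ.E) : Set (Γ.E → ℝ) :=
  {v | v ∈ Γ.voronoi ∧ ∀ γ ∈ Γ.Cir T O,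
      Γ.pair v (Γ.circChainR γ) = Γ.pair (Γ.circChainR γ) (Γ.circChainR γ) / 2}

end SerreGraph


namespace SerreGraph

variable {Γ : SerreGraph}

theorem t_inv (e : Γ.E) : Γ.t (Γ.inv e) = Γ.s e := by
  rw [← Γ.s_inv, Γ.inv_inv]

/-- Layers of vertices admitting a directed walk of given length to `b`. -/
def layer (P : Set Γ.E) (b : Γ.V) : ℕ → Set Γ.V
  | 0 => {b}
  | k + 1 => {v | ∃ f ∈ P, Γ.s f = v ∧ Γ.t f ∈ layer P b k}

theorem reach_iff_exists_layer {P : Set Γ.E} {v b : Γ.V} :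
    Γ.Reach P v b ↔ ∃ k, v ∈ layer P b k := by
  constructor
  · intro h
    induction h using Relation.ReflTransGen.head_induction_on with
    | refl => exact ⟨0, rfl⟩
    | head h _ ih =>
      obtain ⟨f, hf, rfl, rfl⟩ := h
      obtain ⟨k, hk⟩ := ih
      exact ⟨k + 1, f, hf, rfl, hk⟩
  · rintro ⟨k, hk⟩
    induction k generalizing v with
    | zero => obtain rfl : v = b := hk; exact Relation.ReflTransGen.refl
    | succ k ih =>
      obtain ⟨f, hf, rfl, h⟩ := hk
      exact Relation.ReflTransGen.head ⟨f, hf, rfl, rfl⟩ (ih h)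

theorem exists_descent (P : Set Γ.E) (b : Γ.V) :
    ∃ d : Γ.V → ℕ, ∀ v, Γ.Reach P v b → v ≠ b →
      ∃ f ∈ P, Γ.s f = v ∧ Γ.Reach P (Γ.t f) b ∧ d (Γ.t f) < d v := by
  refine ⟨fun v => sInf {k | v ∈ layer P b k}, fun v hv hvb => ?_⟩
  have hmem : v ∈ layer P b (sInf {k | v ∈ layer P b k}) :=
    Nat.sInf_mem (reach_iff_exists_layer.1 hv)
  dsimp only
  generalize sInf {k | v ∈ layer P b k} = m at hmem ⊢
  cases m with
  | zero => exact absurd hmem hvb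
  | succ m =>
    obtain ⟨f, hf, hs, ht⟩ := hmem
    exact ⟨f, hf, hs, reach_iff_exists_layer.2 ⟨m, ht⟩, Nat.lt_succ_of_le (Nat.sInf_le ht)⟩

/-- The orbit of a periodic vertex under a choice of outgoing edges is a circuit. -/
theorem isCircuit_image_orbit {P : Set Γ.E} (hP : ∀ e ∈ P, Γ.inv e ∉ P) (n : Γ.V → Γ.E)
    (b : Γ.V) (S : Finset Γ.V) (N : ℕ) (hN : (fun v => Γ.t (n v))^[N + 1] b = b)
    (hS : ∀ v, v ∈ S ↔ ∃ k, (fun v => Γ.t (n v))^[k] b = v)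
    (hn : ∀ v ∈ S, n v ∈ P ∧ Γ.s (n v) = v) : Γ.IsCircuit (S.image n) := by
  set F : Γ.V → Γ.V := fun v => Γ.t (n v) with hF
  have hFS : ∀ v ∈ S, F v ∈ S := by
    intro v hv
    obtain ⟨k, rfl⟩ := (hS v).1 hv
    exact (hS _).2 ⟨k + 1, Function.iterate_succ_apply' F k b⟩
  have hper : ∀ v ∈ S, F^[N + 1] v = v := by
    intro v hv
    obtain ⟨k, rfl⟩ := (hS v).1 hv
    rw [← Function.iterate_add_apply, add_comm, Function.iterate_add_apply, hN]
  have hFS' : ∀ v ∈ S, ∃ u ∈ S, F u = v := by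
    intro v hv
    obtain ⟨k, hk⟩ := (hS v).1 hv
    refine ⟨F^[k + N] b, (hS _).2 ⟨_, rfl⟩, ?_⟩
    rw [← Function.iterate_succ_apply' F, Nat.succ_eq_add_one, add_assoc,
      Function.iterate_add_apply, hN, hk]
  have hinj : ∀ u ∈ S, ∀ w ∈ S, F u = F w → u = w := by
    intro u hu w hw h
    rw [← hper u hu, ← hper w hw, Function.iterate_succ_apply, Function.iterate_succ_apply, h]
  have hV : ∀ v ∈ (S.image n).image Γ.s ∪ (S.image n).image Γ.t, v ∈ S := by
    intro v hv
    simp only [Finset.mem_union, Finset.mem_image] at hv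
    rcases hv with ⟨_, ⟨u, hu, rfl⟩, rfl⟩ | ⟨_, ⟨u, hu, rfl⟩, rfl⟩
    · rwa [(hn u hu).2]
    · exact hFS u hu
  have hb : b ∈ S := (hS b).2 ⟨0, rfl⟩
  refine ⟨⟨n b, Finset.mem_image_of_mem n hb⟩, ?_, ?_, ?_, ?_⟩
  · intro e he he'
    obtain ⟨u, hu, rfl⟩ := Finset.mem_image.1 he
    obtain ⟨w, hw, hwu⟩ := Finset.mem_image.1 he'
    exact hP _ (hn u hu).1 (hwu ▸ (hn w hw).1)
  · intro v hv
    refine ⟨n v, ⟨Finset.mem_image_of_mem n (hV v hv), (hn v (hV v hv)).2⟩, ?_⟩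
    rintro e ⟨he, hev⟩
    obtain ⟨u, hu, rfl⟩ := Finset.mem_image.1 he
    rw [← hev, (hn u hu).2]
  · intro v hv
    obtain ⟨u, hu, huv⟩ := hFS' v (hV v hv)
    refine ⟨n u, ⟨Finset.mem_image_of_mem n hu, huv⟩, ?_⟩
    rintro e ⟨he, hev⟩
    obtain ⟨w, hw, rfl⟩ := Finset.mem_image.1 he
    rw [hinj w hw u hu (hev.trans huv.symm)]
  · intro e he f hf
    obtain ⟨u, hu, rfl⟩ := Finset.mem_image.1 he
    obtain ⟨w, hw, rfl⟩ := Finset.mem_image.1 hf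
    rw [(hn u hu).2, (hn w hw).2]
    have key : ∀ m, ∀ v ∈ S, Γ.Reach (↑(S.image n) ∪ Γ.inv '' ↑(S.image n)) v (F^[m] v) := by
      intro m
      induction m with
      | zero => exact fun v _ => Relation.ReflTransGen.refl
      | succ m ih =>
        intro v hv
        exact Relation.ReflTransGen.head
          ⟨n v, Or.inl (Finset.mem_coe.2 (Finset.mem_image_of_mem n hv)), (hn v hv).2, rfl⟩
          (ih (F v) (hFS v hv))
    obtain ⟨i, rfl⟩ := (hS u).1 hu
    obtain ⟨j, rfl⟩ := (hS w).1 hw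
    have hreturn : F^[j + N * i] (F^[i] b) = F^[j] b := by
      rw [← Function.iterate_add_apply, show j + N * i + i = j + (N + 1) * i by ring,
        Function.iterate_add_apply, Function.iterate_mul, Function.iterate_fixed hN]
    simpa only [hreturn] using key (j + N * i) _ hu

/-- An edge on a closed directed walk lies on a directed circuit. -/
theorem exists_isCircuit_of_reach {P : Set Γ.E} (hP : ∀ e ∈ P, Γ.inv e ∉ P) {e : Γ.E}
    (he : e ∈ P) (h : Γ.Reach P (Γ.t e) (Γ.s e)) :
    ∃ γ : Finset Γ.E, Γ.IsCircuit γ ∧ (∀ f ∈ γ, f ∈ P) ∧ e ∈ γ := by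
  classical
  obtain ⟨d, hd⟩ := exists_descent P (Γ.s e)
  have hchoice : ∀ v, ∃ f, (v = Γ.s e → f = e) ∧ (Γ.Reach P v (Γ.s e) → v ≠ Γ.s e →
      f ∈ P ∧ Γ.s f = v ∧ Γ.Reach P (Γ.t f) (Γ.s e) ∧ d (Γ.t f) < d v) := by
    intro v
    by_cases hv : v = Γ.s e
    · exact ⟨e, fun _ => rfl, fun _ h => absurd hv h⟩
    · by_cases hr : Γ.Reach P v (Γ.s e)
      · obtain ⟨f, hf⟩ := hd v hr hv
        exact ⟨f, fun h => absurd h hv, fun _ _ => hf⟩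
      · exact ⟨e, fun _ => rfl, fun h => absurd h hr⟩
  choose n hne hn using hchoice
  set F : Γ.V → Γ.V := fun v => Γ.t (n v) with hF
  have hn' : ∀ v, Γ.Reach P v (Γ.s e) →
      n v ∈ P ∧ Γ.s (n v) = v ∧ Γ.Reach P (F v) (Γ.s e) := by
    intro v hv
    by_cases hve : v = Γ.s e
    · simp only [hF, hne v hve]
      exact ⟨he, hve.symm, h⟩
    · obtain ⟨h1, h2, h3, -⟩ := hn v hv hve
      exact ⟨h1, h2, h3⟩
  have hreturn : ∀ m v, d v = m → Γ.Reach P v (Γ.s e) → ∃ k, F^[k] v = Γ.s e := by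
    intro m
    induction m using Nat.strong_induction_on with
    | _ m ih =>
      intro v hvm hv
      by_cases hve : v = Γ.s e
      · exact ⟨0, hve⟩
      · obtain ⟨-, -, h3, h4⟩ := hn v hv hve
        obtain ⟨k, hk⟩ := ih _ (hvm ▸ h4) _ rfl h3
        exact ⟨k + 1, hk⟩
  obtain ⟨N, hN⟩ := hreturn _ _ rfl h
  have hsucc : F^[N + 1] (Γ.s e) = Γ.s e := by
    rw [Function.iterate_succ_apply]
    simpa only [hF, hne _ rfl] using hN
  have horbit : ∀ k, Γ.Reach P (F^[k] (Γ.s e)) (Γ.s e) := by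
    intro k
    induction k with
    | zero => exact Relation.ReflTransGen.refl
    | succ k ih => rw [Function.iterate_succ_apply']; exact (hn' _ ih).2.2
  let S : Finset Γ.V := Finset.univ.filter fun v => ∃ k, F^[k] (Γ.s e) = v
  have hS : ∀ v, v ∈ S ↔ ∃ k, F^[k] (Γ.s e) = v := fun v => by simp [S]
  have hnS : ∀ v ∈ S, n v ∈ P ∧ Γ.s (n v) = v := by
    intro v hv
    obtain ⟨k, rfl⟩ := (hS v).1 hv
    exact ⟨(hn' _ (horbit k)).1, (hn' _ (horbit k)).2.1⟩
  refine ⟨S.image n, isCircuit_image_orbit hP n (Γ.s e) S N hsucc hS hnS, ?_, ?_⟩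
  · intro f hf
    obtain ⟨u, hu, rfl⟩ := Finset.mem_image.1 hf
    exact (hnS u hu).1
  · exact Finset.mem_image.2 ⟨Γ.s e, (hS _).2 ⟨0, rfl⟩, hne _ rfl⟩

/-- `H₁(Γ∖T,A)` as a subgroup of all functions on oriented edges. -/
def cyclesOn (Γ : SerreGraph) (A : Type*) [AddCommGroup A] (T : Set Γ.E) :
    AddSubgroup (Γ.E → A) where
  carrier := {c | Γ.IsCycleOn T c}
  zero_mem' := ⟨⟨by simp, by simp⟩, by simp⟩
  add_mem' := by
    rintro a b ⟨⟨h1, h2⟩, h3⟩ ⟨⟨h1', h2'⟩, h3'⟩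
    refine ⟨⟨fun e => ?_, fun v => ?_⟩, fun e he => ?_⟩
    · simp only [Pi.add_apply, h1, h1', neg_add]
    · simp only [Pi.add_apply, Finset.sum_add_distrib, h2, h2', add_zero]
    · simp only [Pi.add_apply, h3 e he, h3' e he, add_zero]
  neg_mem' := by
    rintro a ⟨⟨h1, h2⟩, h3⟩
    refine ⟨⟨fun e => ?_, fun v => ?_⟩, fun e he => ?_⟩
    · simp only [Pi.neg_apply, h1]
    · simp only [Pi.neg_apply, Finset.sum_neg_distrib, h2, neg_zero]
    · simp only [Pi.neg_apply, h3 e he, neg_zero]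

theorem mem_cyclesOn {A : Type*} [AddCommGroup A] {T : Set Γ.E} {c : Γ.E → A} :
    c ∈ cyclesOn Γ A T ↔ Γ.IsCycleOn T c := Iff.rfl

theorem IsCircuit.isCycle_circChainZ {γ : Finset Γ.E} (h : Γ.IsCircuit γ) :
    Γ.IsCycle (Γ.circChainZ γ) := by
  obtain ⟨-, hinv, hs, ht, -⟩ := h
  have hchain : ∀ e, Γ.circChainZ γ e =
      (if e ∈ γ then 1 else 0) - if Γ.inv e ∈ γ then 1 else 0 := by
    intro e
    have := hinv e
    unfold circChainZ
    split_ifs <;> simp_all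
  refine ⟨fun e => by rw [hchain, hchain, Γ.inv_inv]; ring, fun v => ?_⟩
  simp only [hchain, Finset.sum_sub_distrib]
  have hout : (∑ e ∈ Finset.univ.filter (fun e => Γ.t e = v),
      if Γ.inv e ∈ γ then (1 : ℤ) else 0) =
      ∑ e ∈ Finset.univ.filter (fun e => Γ.s e = v), if e ∈ γ then (1 : ℤ) else 0 := by
    refine Finset.sum_bij' (fun e _ => Γ.inv e) (fun e _ => Γ.inv e) ?_ ?_ ?_ ?_ ?_ <;>
      simp [Γ.inv_inv, Γ.s_inv, t_inv]
  rw [hout, Finset.sum_boole, Finset.sum_boole, Finset.filter_filter, Finset.filter_filter]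
  by_cases hv : v ∈ γ.image Γ.s ∪ γ.image Γ.t
  · have hone : ∀ q : Γ.E → Γ.V, (∃! e, e ∈ γ ∧ q e = v) →
        (Finset.univ.filter fun e => q e = v ∧ e ∈ γ).card = 1 := by
      rintro q ⟨e, ⟨he, hev⟩, huniq⟩
      rw [Finset.card_eq_one]
      refine ⟨e, Finset.ext fun f => ?_⟩
      simp only [Finset.mem_filter, Finset.mem_univ, true_and, Finset.mem_singleton]
      exact ⟨fun hf => huniq f ⟨hf.2, hf.1⟩, fun hf => hf ▸ ⟨hev, he⟩⟩
    rw [hone _ (hs v hv), hone _ (ht v hv), sub_self]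
  · simp only [Finset.mem_union, Finset.mem_image, not_or, not_exists, not_and] at hv
    rw [Finset.filter_false_of_mem fun e _ he => hv.2 e he.2 he.1,
      Finset.filter_false_of_mem fun e _ he => hv.1 e he.2 he.1, sub_self]

theorem circChainZ_mem_cyclesOn {T O : Set Γ.E} (hT : Γ.InvClosed T) {γ : Finset Γ.E}
    (h : γ ∈ Γ.Cir T O) : Γ.circChainZ γ ∈ cyclesOn Γ ℤ T := by
  refine ⟨h.1.isCycle_circChainZ, fun e he => ?_⟩
  have h1 : e ∉ γ := fun h' => h.2.2 e h' he
  have h2 : Γ.inv e ∉ γ := fun h' => h.2.2 _ h' ((hT e).1 he)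
  simp [circChainZ, h1, h2]

theorem circChainZ_eq_of_mem {T O : Set Γ.E} (hO : Γ.IsOrientation T O) {γ : Finset Γ.E}
    (h : γ ∈ Γ.Cir T O) {e : Γ.E} (he : e ∈ O) :
    Γ.circChainZ γ e = if e ∈ γ then 1 else 0 := by
  have h2 : Γ.inv e ∉ γ := fun h' => (hO.2 e (hO.1 e he)).1 he (h.2.1 _ h')
  simp [circChainZ, h2]

/-- In a totally cyclic orientation every edge lies on a compatible circuit. -/
theorem IsTotallyCyclic.exists_mem_cir {T O : Set Γ.E} (h : Γ.IsTotallyCyclic T O)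
    {e : Γ.E} (he : e ∈ O) : ∃ γ ∈ Γ.Cir T O, e ∈ γ := by
  obtain ⟨hO, hW⟩ := h
  have hreach : Γ.Reach O (Γ.t e) (Γ.s e) := by
    by_contra hcon
    refine hW ⟨{v | Γ.Reach O v (Γ.s e)}, ⟨Γ.s e, Relation.ReflTransGen.refl, Γ.t e, hcon,
      Relation.ReflTransGen.single ⟨e, hO.1 e he, rfl, rfl⟩⟩, fun f hf hft => ?_⟩
    exact Relation.ReflTransGen.head ⟨f, hf, rfl, rfl⟩ hft
  obtain ⟨γ, h1, h2, h3⟩ :=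
    exists_isCircuit_of_reach (fun f hf => (hO.2 f (hO.1 f hf)).1 hf) he hreach
  exact ⟨γ, ⟨h1, h2, fun f hf => hO.1 f (h2 f hf)⟩, h3⟩

/-- The net flow of a cycle into a vertex set vanishes. -/
theorem IsCycle.sum_boundary_eq_zero {c : Γ.E → ℤ} (hc : Γ.IsCycle c) (W : Set Γ.V)
    [DecidablePred (· ∈ W)] :
    ∑ e ∈ Finset.univ.filter (fun e => Γ.t e ∈ W ∧ Γ.s e ∉ W), c e = 0 := by
  have hin : ∑ e ∈ Finset.univ.filter (fun e => Γ.t e ∈ W), c e = 0 := by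
    rw [← Finset.sum_fiberwise_of_maps_to (t := Finset.univ.filter (· ∈ W)) (g := Γ.t)
      (by simp)]
    refine Finset.sum_eq_zero fun v hv => ?_
    rw [Finset.filter_filter, ← hc.2 v]
    refine Finset.sum_congr (Finset.filter_congr fun e _ => ?_) fun _ _ => rfl
    simp only [Finset.mem_filter, Finset.mem_univ, true_and] at hv
    exact ⟨fun h => h.2, fun h => ⟨h ▸ hv, h⟩⟩
  have hinner : ∑ e ∈ Finset.univ.filter (fun e => Γ.t e ∈ W ∧ Γ.s e ∈ W), c e = 0 := by
    have : ∑ e ∈ Finset.univ.filter (fun e => Γ.t e ∈ W ∧ Γ.s e ∈ W), c e =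
        ∑ e ∈ Finset.univ.filter (fun e => Γ.t e ∈ W ∧ Γ.s e ∈ W), - c e := by
      refine Finset.sum_bij' (fun e _ => Γ.inv e) (fun e _ => Γ.inv e) ?_ ?_ ?_ ?_ ?_ <;>
        simp +contextual [Γ.inv_inv, Γ.s_inv, t_inv, hc.1]
    rw [Finset.sum_neg_distrib] at this
    lia
  have hsplit := Finset.sum_filter_add_sum_filter_not
    (Finset.univ.filter fun e => Γ.t e ∈ W) (fun e => Γ.s e ∈ W) c
  rw [Finset.filter_filter, Finset.filter_filter, hin, hinner, zero_add] at hsplit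
  exact hsplit

/-- A nonnegative cycle contains, through any edge of positive flow, a circuit of positive flow. -/
theorem exists_mem_cir_pos {T O : Set Γ.E} (hO : Γ.IsOrientation T O) {c : Γ.E → ℤ}
    (hc : Γ.IsCycleOn T c) (hnn : ∀ e ∈ O, 0 ≤ c e) {e : Γ.E} (he : e ∈ O) (hpos : 0 < c e) :
    ∃ γ ∈ Γ.Cir T O, (∀ f ∈ γ, 0 < c f) ∧ e ∈ γ := by
  classical
  let P : Set Γ.E := {f | f ∈ O ∧ 0 < c f}
  have hreach : Γ.Reach P (Γ.t e) (Γ.s e) := by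
    by_contra hcon
    let W : Set Γ.V := {v | Γ.Reach P v (Γ.s e)}
    have hnonpos : ∀ f ∈ Finset.univ.filter (fun f => Γ.t f ∈ W ∧ Γ.s f ∉ W), c f ≤ 0 := by
      intro f hf
      simp only [Finset.mem_filter, Finset.mem_univ, true_and] at hf
      by_cases hfT : f ∈ T
      · exact (hc.2 f hfT).le
      by_cases hfO : f ∈ O
      · by_contra! hcf
        exact hf.2 (Relation.ReflTransGen.head ⟨f, ⟨hfO, hcf⟩, rfl, rfl⟩ hf.1)
      · have := hnn (Γ.inv f) (by by_contra h; exact hfO ((hO.2 f hfT).2 h))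
        rw [hc.1.1] at this
        lia
    have hzero := (Finset.sum_eq_zero_iff_of_nonpos hnonpos).1
      (hc.1.sum_boundary_eq_zero W) (Γ.inv e) (by
        simp only [Finset.mem_filter, Finset.mem_univ, true_and, t_inv, Γ.s_inv]
        exact ⟨Relation.ReflTransGen.refl, hcon⟩)
    rw [hc.1.1] at hzero
    lia
  obtain ⟨γ, h1, h2, h3⟩ := exists_isCircuit_of_reach (P := P)
    (fun f hf h => (hO.2 f (hO.1 f hf.1)).1 hf.1 h.1) ⟨he, hpos⟩ hreach
  exact ⟨γ, ⟨h1, fun f hf => (h2 f hf).1, fun f hf => hO.1 f (h2 f hf).1⟩,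
    fun f hf => (h2 f hf).2, h3⟩

/-- A nonnegative integral cycle is a sum of circuits. -/
theorem mem_closure_of_nonneg {T O : Set Γ.E} (hT : Γ.InvClosed T) (hO : Γ.IsOrientation T O)
    {c : Γ.E → ℤ} (hc : Γ.IsCycleOn T c) (hnn : ∀ e ∈ O, 0 ≤ c e) :
    c ∈ AddSubgroup.closure {c' | ∃ γ ∈ Γ.Cir T O, c' = Γ.circChainZ γ} := by
  classical
  generalize hm : (∑ e ∈ Finset.univ.filter (· ∈ O), c e).toNat = m
  induction m using Nat.strong_induction_on generalizing c with
  | _ m ih =>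
    by_cases hzero : ∀ e ∈ O, c e = 0
    · have : c = 0 := by
        funext e
        by_cases heT : e ∈ T
        · exact hc.2 e heT
        by_cases heO : e ∈ O
        · exact hzero e heO
        · have := hzero (Γ.inv e) (by by_contra h; exact heO ((hO.2 e heT).2 h))
          rw [hc.1.1] at this
          exact neg_eq_zero.1 this
      rw [this]
      exact zero_mem _
    push Not at hzero
    obtain ⟨e, he, hce⟩ := hzero
    obtain ⟨γ, hγ, hγpos, heγ⟩ :=
      exists_mem_cir_pos hO hc hnn he (lt_of_le_of_ne (hnn e he) hce.symm)
    have hnn' : ∀ f ∈ O, 0 ≤ (c - Γ.circChainZ γ) f := by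
      intro f hf
      rw [Pi.sub_apply, circChainZ_eq_of_mem hO hγ hf]
      split_ifs with hfγ
      · have := hγpos f hfγ
        lia
      · simpa using hnn f hf
    have hlt : ∑ f ∈ Finset.univ.filter (· ∈ O), (c - Γ.circChainZ γ) f <
        ∑ f ∈ Finset.univ.filter (· ∈ O), c f := by
      refine Finset.sum_lt_sum (fun f hf => ?_) ⟨e, by simpa using he, ?_⟩
      · rw [Pi.sub_apply, circChainZ_eq_of_mem hO hγ (by simpa using hf)]
        split_ifs <;> simp
      · simp [circChainZ_eq_of_mem hO hγ he, heγ]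
    have hge : 0 ≤ ∑ f ∈ Finset.univ.filter (· ∈ O), (c - Γ.circChainZ γ) f :=
      Finset.sum_nonneg fun f hf => hnn' f (by simpa using hf)
    have hmem := ih _ (by lia) (mem_cyclesOn.1 (sub_mem (mem_cyclesOn.2 hc)
      (circChainZ_mem_cyclesOn hT hγ))) hnn' rfl
    rw [← sub_add_cancel c (Γ.circChainZ γ)]
    exact add_mem hmem (AddSubgroup.subset_closure ⟨γ, hγ, rfl⟩)

/-- A totally cyclic orientation carries a sum of circuits that is positive on every edge. -/
theorem IsTotallyCyclic.exists_pos {T O : Set Γ.E} (h : Γ.IsTotallyCyclic T O) :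
    ∃ b ∈ AddSubgroup.closure {c' | ∃ γ ∈ Γ.Cir T O, c' = Γ.circChainZ γ},
      ∀ e ∈ O, 1 ≤ b e := by
  classical
  choose! g hg hmem using fun e (he : e ∈ O) => h.exists_mem_cir he
  refine ⟨∑ f ∈ Finset.univ.filter (· ∈ O), Γ.circChainZ (g f), sum_mem fun f hf =>
    AddSubgroup.subset_closure ⟨g f, hg f (by simpa using hf), rfl⟩, fun e he => ?_⟩
  rw [Finset.sum_apply]
  have hle := Finset.single_le_sum (s := Finset.univ.filter (· ∈ O))
    (f := fun f => Γ.circChainZ (g f) e) (fun f hf => ?_) (a := e) (by simpa using he)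
  · simpa [circChainZ_eq_of_mem h.1 (hg e he) he, hmem e he] using hle
  · rw [circChainZ_eq_of_mem h.1 (hg f (by simpa using hf)) he]
    split_ifs <;> simp

end SerreGraph

/-- For `(T,φ) ∈ OP_Γ`, the subgroup of `H₁(Γ,ℤ)` generated
by the classes `[γ]`, `γ ∈ Cir_φ(Γ∖T)`, equals `H₁(Γ∖T,ℤ)`. -/
theorem stmt17 (Γ : SerreGraph) (p : Set Γ.E × Set Γ.E) (hp : p ∈ Γ.OP) :
    ∀ c : Γ.E → ℤ,
      (c ∈ AddSubgroup.closure {c' | ∃ γ ∈ Γ.Cir p.1 p.2, c' = Γ.circChainZ γ} ↔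
        Γ.IsCycleOn p.1 c) := by
  obtain ⟨hT, hcyc⟩ := hp
  have hle : AddSubgroup.closure {c' | ∃ γ ∈ Γ.Cir p.1 p.2, c' = Γ.circChainZ γ} ≤
      SerreGraph.cyclesOn Γ ℤ p.1 := by
    rw [AddSubgroup.closure_le]
    rintro _ ⟨γ, hγ, rfl⟩
    exact SerreGraph.circChainZ_mem_cyclesOn hT hγ
  intro c
  refine ⟨fun h => hle h, fun hc => ?_⟩
  obtain ⟨b, hb, hbpos⟩ := hcyc.exists_pos
  let N : ℤ := ∑ e, |c e|
  have hN : ∀ e, |c e| ≤ N := fun e =>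
    Finset.single_le_sum (f := fun e => |c e|) (fun _ _ => abs_nonneg _) (Finset.mem_univ e)
  have hNb := zsmul_mem hb N
  rw [← add_sub_cancel_right c (N • b)]
  refine sub_mem (SerreGraph.mem_closure_of_nonneg hT hcyc.1 (SerreGraph.mem_cyclesOn.1
    (add_mem (SerreGraph.mem_cyclesOn.2 hc) (hle hNb))) fun e he => ?_) hNb
  have h1 := hN e
  have h2 := neg_abs_le (c e)
  have h3 := hbpos e he
  have h4 := abs_nonneg (c e)
  simp only [Pi.add_apply, Pi.smul_apply, smul_eq_mul]
  nlinarith
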